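/- Suppose ν·C₂ < 1/d and ‖λ_o − λ_r‖ < (2/C₁)·(1/(d·C₂) − ν). Then the successive estimates produced by the iterative tangent distance method — λ_e⁰ = λ_r, and for each k ≥ 1, λ_e^k is the tangent distance estimate computed with reference parameter λ_e^{k−1} — converge to λ_o: lim_{k→∞} λ_e^k = λ_o. Moreover ‖λ_e^k − λ_o‖ ≤ α^k ‖λ_o − λ_r‖ for all k with α := (1/2)·d·C₁·C₂·‖λ_o − λ_r‖ + d·ν·C₂ < 1. -/

import Mathlib

open scoped RealInnerProductSpace BigOperators

/-- The `i`-th partial derivative `∂ᵢp(x) ∈ H` of a map `p : ℝᵈ → H`. -/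
noncomputable def pderiv {H : Type*} [NormedAddCommGroup H] [NormedSpace ℝ H] {d : ℕ}
    (p : EuclideanSpace ℝ (Fin d) → H) (i : Fin d) (x : EuclideanSpace ℝ (Fin d)) : H :=
  fderiv ℝ p x (EuclideanSpace.single i 1)

/-- The second partial derivative `∂ᵢⱼp(x) ∈ H`. -/
noncomputable def pderiv2 {H : Type*} [NormedAddCommGroup H] [NormedSpace ℝ H] {d : ℕ}
    (p : EuclideanSpace ℝ (Fin d) → H) (i j : Fin d) (x : EuclideanSpace ℝ (Fin d)) : H :=
  fderiv ℝ (fun y => pderiv p j y) x (EuclideanSpace.single i 1)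

/-- The Gram (metric) matrix `G(x)ᵢⱼ = ⟨∂ᵢp(x), ∂ⱼp(x)⟩`. -/
noncomputable def gram {H : Type*} [NormedAddCommGroup H] [InnerProductSpace ℝ H] {d : ℕ}
    (p : EuclideanSpace ℝ (Fin d) → H) (x : EuclideanSpace ℝ (Fin d)) :
    Matrix (Fin d) (Fin d) ℝ :=
  Matrix.of fun i j => ⟪pderiv p i x, pderiv p j x⟫

/-- Smallest eigenvalue of a symmetric real matrix. -/
noncomputable def etaMin {d : ℕ} (A : Matrix (Fin d) (Fin d) ℝ) : ℝ :=
  if h : A.IsHermitian then ⨅ i, h.eigenvalues i else 0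


/-- The Rayleigh quotient of a Hermitian matrix is at least its smallest eigenvalue. -/
lemma etaMin_mul_norm_sq_le {d : ℕ} {A : Matrix (Fin d) (Fin d) ℝ} (hA : A.IsHermitian)
    (w : EuclideanSpace ℝ (Fin d)) :
    etaMin A * ‖w‖ ^ 2 ≤ ∑ i, w i * ∑ j, A i j * w j := by
  have hquad : ∑ i, w i * ∑ j, A i j * w j
      = ∑ k, hA.eigenvalues k * ⟪hA.eigenvectorBasis k, w⟫ ^ 2 := by
    have hsymm : A.toEuclideanLin.IsSymmetric := Matrix.isSymmetric_toEuclideanLin_iff.mpr hA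
    have heig (k : Fin d) : A.toEuclideanLin (hA.eigenvectorBasis k)
        = hA.eigenvalues k • hA.eigenvectorBasis k := by
      ext i
      simpa [Matrix.toLpLin_apply] using congrFun (hA.mulVec_eigenvectorBasis k) i
    have hleft : ∑ i, w i * ∑ j, A i j * w j = ⟪w, A.toEuclideanLin w⟫ := by
      simp [PiLp.inner_apply, Matrix.toLpLin_apply, Matrix.mulVec, dotProduct, mul_comm]
    rw [hleft, ← hA.eigenvectorBasis.sum_inner_mul_inner]
    refine Finset.sum_congr rfl fun k _ => ?_
    rw [← hsymm, heig, real_inner_smul_left, real_inner_comm w]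
    ring
  have hnorm := hA.eigenvectorBasis.sum_sq_norm_inner_right w
  rw [hquad, ← hnorm, Finset.mul_sum]
  refine Finset.sum_le_sum fun k _ => ?_
  rw [Real.norm_eq_abs, sq_abs, etaMin, dif_pos hA]
  gcongr
  exact ciInf_le (Set.finite_range _).bddBelow k

lemma etaMin_pos {d : ℕ} (hd : 0 < d) {A : Matrix (Fin d) (Fin d) ℝ} (hA : A.PosDef) :
    0 < etaMin A := by
  have : Nonempty (Fin d) := ⟨⟨0, hd⟩⟩
  rw [etaMin, dif_pos hA.1]
  obtain ⟨i, hi⟩ := exists_eq_ciInf_of_finite (f := hA.1.eigenvalues)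
  rw [← hi]
  exact hA.eigenvalues_pos i

/-- A continuous linear map on Euclidean space is the sum of its values on the basis vectors. -/
lemma ContinuousLinearMap.eq_sum_smul_single {F : Type*} [NormedAddCommGroup F]
    [NormedSpace ℝ F] {d : ℕ} (L : EuclideanSpace ℝ (Fin d) →L[ℝ] F)
    (w : EuclideanSpace ℝ (Fin d)) :
    L w = ∑ i, w i • L (EuclideanSpace.single i 1) := by
  conv_lhs => rw [← (EuclideanSpace.basisFun (Fin d) ℝ).sum_repr w]
  simp [map_sum]

/-- Cauchy-Schwarz bound for a linear combination of vectors. -/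
lemma norm_sum_smul_le_sqrt {F ι : Type*} [NormedAddCommGroup F] [NormedSpace ℝ F] [Fintype ι]
    (w : EuclideanSpace ℝ ι) (v : ι → F) :
    ‖∑ i, w i • v i‖ ≤ √(∑ i, ‖v i‖ ^ 2) * ‖w‖ := by
  rw [EuclideanSpace.norm_eq, mul_comm]
  calc ‖∑ i, w i • v i‖ ≤ ∑ i, ‖w i‖ * ‖v i‖ :=
        (norm_sum_le _ _).trans_eq (Finset.sum_congr rfl fun i _ => norm_smul _ _)
    _ ≤ _ := Real.sum_mul_le_sqrt_mul_sqrt _ _ _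

/-- If the entries of a bilinear map are bounded by `K`, its operator norm is at most `d * K`. -/
lemma ContinuousLinearMap.opNorm_le_of_single_single_le {F : Type*} [NormedAddCommGroup F]
    [NormedSpace ℝ F] {d : ℕ}
    (B : EuclideanSpace ℝ (Fin d) →L[ℝ] EuclideanSpace ℝ (Fin d) →L[ℝ] F) {K : ℝ} (hK : 0 ≤ K)
    (hB : ∀ i j, ‖B (EuclideanSpace.single i 1) (EuclideanSpace.single j 1)‖ ≤ K) :
    ‖B‖ ≤ d * K := by
  have hsqrt {a : ℝ} (ha : 0 ≤ a) : √(∑ _i : Fin d, a ^ 2) = √d * a := by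
    rw [Finset.sum_const, Finset.card_univ, Fintype.card_fin, nsmul_eq_mul,
      Real.sqrt_mul d.cast_nonneg, Real.sqrt_sq ha]
  have hrow (i : Fin d) : ‖B (EuclideanSpace.single i 1)‖ ≤ √d * K := by
    refine ContinuousLinearMap.opNorm_le_bound _ (by positivity) fun w => ?_
    rw [(B (EuclideanSpace.single i 1)).eq_sum_smul_single w, ← hsqrt hK]
    refine (norm_sum_smul_le_sqrt _ _).trans ?_
    gcongr with j
    exact hB i j
  refine ContinuousLinearMap.opNorm_le_bound _ (by positivity) fun w => ?_
  have hd : (d : ℝ) * K = √(∑ _i : Fin d, (√d * K) ^ 2) := by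
    rw [hsqrt (by positivity), ← mul_assoc, Real.mul_self_sqrt d.cast_nonneg]
  rw [B.eq_sum_smul_single w, hd]
  refine (norm_sum_smul_le_sqrt _ _).trans ?_
  gcongr with i
  exact hrow i

/-- First-order Taylor estimate for a map whose derivative is Lipschitz. -/
lemma norm_sub_sub_fderiv_le_of_fderiv_lipschitz {E F : Type*} [NormedAddCommGroup E]
    [NormedSpace ℝ E] [NormedAddCommGroup F] [NormedSpace ℝ F] {f : E → F} {L : ℝ}
    (hf : Differentiable ℝ f) (hL : ∀ x y, ‖fderiv ℝ f y - fderiv ℝ f x‖ ≤ L * ‖y - x‖)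
    (x y : E) :
    ‖f y - f x - fderiv ℝ f x (y - x)‖ ≤ L / 2 * ‖y - x‖ ^ 2 := by
  set v := y - x with hv
  have hline (t : ℝ) : HasDerivAt (fun t : ℝ => x + t • v) v t := by
    simpa using ((hasDerivAt_id t).smul_const v).const_add x
  have hg (t : ℝ) : HasDerivAt (fun t : ℝ => f (x + t • v) - f x - t • fderiv ℝ f x v)
      (fderiv ℝ f (x + t • v) v - fderiv ℝ f x v) t := by
    have h1 := (hf (x + t • v)).hasFDerivAt.comp_hasDerivAt t (hline t)
    have h2 := (hasDerivAt_id t).smul_const (fderiv ℝ f x v)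
    simpa using! (h1.sub_const (f x)).sub h2
  have hB (t : ℝ) : HasDerivAt (fun t : ℝ => L / 2 * ‖v‖ ^ 2 * t ^ 2) (L * ‖v‖ ^ 2 * t) t := by
    convert! (hasDerivAt_pow 2 t).const_mul (L / 2 * ‖v‖ ^ 2) using 1
    norm_num
    ring
  have key := image_norm_le_of_norm_deriv_right_le_deriv_boundary (a := (0 : ℝ)) (b := 1)
    (fun t _ => (hg t).continuousAt.continuousWithinAt) (fun t _ => (hg t).hasDerivWithinAt)
    (by simp) hB (fun t ht => by
      rw [← sub_apply]
      refine (ContinuousLinearMap.le_opNorm _ _).trans ?_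
      have := hL x (x + t • v)
      rw [add_sub_cancel_left, norm_smul, Real.norm_of_nonneg ht.1] at this
      calc _ ≤ L * (t * ‖v‖) * ‖v‖ := by gcongr
        _ = _ := by ring)
    (Set.right_mem_Icc.mpr zero_le_one)
  simpa [hv] using key

section TangentDistance

variable {H : Type*} [NormedAddCommGroup H] [InnerProductSpace ℝ H] {d : ℕ}
  {p : EuclideanSpace ℝ (Fin d) → H}

/-- The derivative of a map is Lipschitz when its second partial derivatives are bounded. -/
lemma norm_fderiv_sub_fderiv_le (hp : ContDiff ℝ 2 p) {K : ℝ} (hK : 0 ≤ K)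
    (hKb : ∀ x i j, ‖pderiv2 p i j x‖ ≤ K) (x y : EuclideanSpace ℝ (Fin d)) :
    ‖fderiv ℝ p y - fderiv ℝ p x‖ ≤ d * K * ‖y - x‖ := by
  have hdiff : Differentiable ℝ (fderiv ℝ p) :=
    (hp.fderiv_right (m := 1) (by norm_num)).differentiable (by norm_num)
  refine convex_univ.norm_image_sub_le_of_norm_fderiv_le (𝕜 := ℝ) (fun z _ => hdiff z)
    (fun z _ => ?_) (Set.mem_univ x) (Set.mem_univ y)
  refine ContinuousLinearMap.opNorm_le_of_single_single_le _ hK fun i j => ?_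
  have h : pderiv2 p i j z
      = fderiv ℝ (fderiv ℝ p) z (EuclideanSpace.single i 1) (EuclideanSpace.single j 1) := by
    simp only [pderiv2, pderiv]
    rw [fderiv_clm_apply (hdiff z) (differentiableAt_const _)]
    simp
  exact h ▸ hKb z i j

lemma sum_mul_sum_gram_mul (x u v : EuclideanSpace ℝ (Fin d)) :
    ∑ i, u i * ∑ j, gram p x i j * v j = ⟪fderiv ℝ p x u, fderiv ℝ p x v⟫ := by
  rw [(fderiv ℝ p x).eq_sum_smul_single u, (fderiv ℝ p x).eq_sum_smul_single v]
  simp only [sum_inner, inner_sum, real_inner_smul_left, real_inner_smul_right, gram, pderiv,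
    Matrix.of_apply, Finset.mul_sum]
  rw [Finset.sum_comm]
  exact Finset.sum_congr rfl fun i _ => Finset.sum_congr rfl fun j _ => by ring

lemma norm_fderiv_apply_le_sqrt_trace_gram (x w : EuclideanSpace ℝ (Fin d)) :
    ‖fderiv ℝ p x w‖ ≤ √(gram p x).trace * ‖w‖ := by
  rw [(fderiv ℝ p x).eq_sum_smul_single w]
  refine (norm_sum_smul_le_sqrt _ _).trans_eq ?_
  simp [Matrix.trace, gram, pderiv]

/-- The defining normal equation of the tangent distance estimate `y` with reference `x`, tested
against a direction `w`. -/
lemma inner_fderiv_apply_eq_of_tangent_distance {x y : EuclideanSpace ℝ (Fin d)} {q : H}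
    (hG : (gram p x).PosDef)
    (hy : ∀ i, y i = x i + ∑ j, (gram p x)⁻¹ i j * ⟪q - p x, pderiv p j x⟫)
    (w : EuclideanSpace ℝ (Fin d)) :
    ⟪fderiv ℝ p x w, fderiv ℝ p x (y - x)⟫ = ⟪q - p x, fderiv ℝ p x w⟫ := by
  set b : Fin d → ℝ := fun j => ⟪q - p x, pderiv p j x⟫ with hb
  have hstep : (fun i => (y - x) i) = (gram p x)⁻¹.mulVec b := by
    funext i
    simp [hy i, Matrix.mulVec, dotProduct, hb]
  have hsolve (i : Fin d) : ∑ j, gram p x i j * (y - x) j = b i := by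
    have h : (gram p x).mulVec (fun i => (y - x) i) = b := by
      rw [hstep, Matrix.mulVec_mulVec, Matrix.mul_nonsing_inv _ hG.det_pos.ne'.isUnit,
        Matrix.one_mulVec]
    exact congrFun h i
  rw [← sum_mul_sum_gram_mul, (fderiv ℝ p x).eq_sum_smul_single w, inner_sum]
  simp only [hsolve, real_inner_smul_right, hb, pderiv]

/-- One-step error estimate for the tangent distance method. -/
lemma norm_tangent_distance_sub_le (hd : 0 < d) (hp : ContDiff ℝ 2 p) {K : ℝ} (hK : 0 ≤ K)
    (hKb : ∀ x i j, ‖pderiv2 p i j x‖ ≤ K) {C1 C2 : ℝ} {x y lo : EuclideanSpace ℝ (Fin d)}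
    (hG : (gram p x).PosDef) (hC1b : √(gram p x).trace ≤ C1)
    (hC2b : K * (etaMin (gram p x))⁻¹ ≤ C2) {n : H} (hn : ∀ i, ⟪n, pderiv p i lo⟫ = 0)
    (hy : ∀ i, y i = x i + ∑ j, (gram p x)⁻¹ i j * ⟪p lo + n - p x, pderiv p j x⟫) :
    ‖y - lo‖ ≤ (1 / 2 * d * C1 * C2 * ‖lo - x‖ + d * ‖n‖ * C2) * ‖lo - x‖ := by
  set w := y - lo with hw
  set δ := lo - x with hδ
  set η := etaMin (gram p x) with hη
  have hηpos : 0 < η := etaMin_pos hd hG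
  have hC1 : 0 ≤ C1 := (Real.sqrt_nonneg _).trans hC1b
  have hlip := norm_fderiv_sub_fderiv_le hp hK hKb
  have htaylor : ‖p lo - p x - fderiv ℝ p x δ‖ ≤ d * K / 2 * ‖δ‖ ^ 2 :=
    norm_sub_sub_fderiv_le_of_fderiv_lipschitz (hp.differentiable (by norm_num)) hlip x lo
  have hortho : ⟪n, fderiv ℝ p lo w⟫ = 0 := by
    rw [(fderiv ℝ p lo).eq_sum_smul_single w, inner_sum]
    refine Finset.sum_eq_zero fun i _ => ?_
    rw [real_inner_smul_right]
    exact mul_eq_zero_of_right _ (hn i)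
  have hnormal : ⟪fderiv ℝ p x w, fderiv ℝ p x w⟫
      = ⟪p lo - p x - fderiv ℝ p x δ, fderiv ℝ p x w⟫
        - ⟪n, (fderiv ℝ p lo - fderiv ℝ p x) w⟫ := by
    have h := inner_fderiv_apply_eq_of_tangent_distance hG hy w
    rw [show y - x = w + δ by rw [hw, hδ]; abel, map_add, inner_add_right,
      show p lo + n - p x = (p lo - p x) + n by abel, inner_add_left] at h
    rw [sub_apply, inner_sub_right, hortho, inner_sub_left,
      real_inner_comm (fderiv ℝ p x w) (fderiv ℝ p x δ)]
    linarith
  have htangent : ‖fderiv ℝ p x w‖ ≤ C1 * ‖w‖ :=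
    (norm_fderiv_apply_le_sqrt_trace_gram x w).trans (by gcongr)
  have hcurv : ⟪p lo - p x - fderiv ℝ p x δ, fderiv ℝ p x w⟫
      ≤ d * K / 2 * ‖δ‖ ^ 2 * (C1 * ‖w‖) :=
    (real_inner_le_norm _ _).trans (by gcongr)
  have hnoise : -⟪n, (fderiv ℝ p lo - fderiv ℝ p x) w⟫ ≤ ‖n‖ * (d * K * ‖δ‖ * ‖w‖) := by
    refine (neg_le_abs _).trans ((abs_real_inner_le_norm _ _).trans ?_)
    gcongr
    exact (ContinuousLinearMap.le_opNorm _ _).trans (by gcongr; exact hlip x lo)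
  have hlower := etaMin_mul_norm_sq_le hG.1 w
  rw [sum_mul_sum_gram_mul, hnormal, ← hη] at hlower
  set c : ℝ := (1 / 2 * d * C1 * ‖δ‖ + d * ‖n‖) * ‖δ‖ with hc
  have hmul : η * ‖w‖ * ‖w‖ ≤ K * c * ‖w‖ := by
    rw [hc]
    linarith
  have hc0 : 0 ≤ c := by positivity
  have hη_le : η * ‖w‖ ≤ K * c := by
    rcases (norm_nonneg w).eq_or_lt' with h0 | hpos
    · rw [h0, mul_zero]
      positivity
    · exact le_of_mul_le_mul_right hmul hpos
  calc ‖w‖ ≤ K * c / η := by rwa [le_div_iff₀' hηpos]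
    _ = K * η⁻¹ * c := by ring
    _ ≤ C2 * c := by gcongr
    _ = _ := by rw [hc]; ring

end TangentDistance

/-- Convergence of the single-scale iterative tangent distance method. -/
theorem tangent_distance_single_scale_convergence
    {H : Type*} [NormedAddCommGroup H] [InnerProductSpace ℝ H]
    {d : ℕ} (hd : 0 < d)
    (p : EuclideanSpace ℝ (Fin d) → H) (hp : ContDiff ℝ 2 p)
    (K : ℝ) (hK : 0 ≤ K)
    (hKb : ∀ (x : EuclideanSpace ℝ (Fin d)) (i j : Fin d), ‖pderiv2 p i j x‖ ≤ K)
    (hPD : ∀ x, (gram p x).PosDef)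
    (C1 C2 : ℝ) (hC1 : 0 < C1) (hC2 : 0 < C2)
    (hC1b : ∀ x, Real.sqrt (gram p x).trace ≤ C1)
    (hC2b : ∀ x, K * (etaMin (gram p x))⁻¹ ≤ C2)
    (lr lo : EuclideanSpace ℝ (Fin d))
    (n : H) (hn : ∀ i, ⟪n, pderiv p i lo⟫ = 0)
    (ν : ℝ) (hν : ν = ‖n‖)
    (q : H) (hq : q = p lo + n)
    (hnoise : ν * C2 < 1 / (d : ℝ))
    (hinit : ‖lo - lr‖ < 2 / C1 * (1 / ((d : ℝ) * C2) - ν))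
    (seq : ℕ → EuclideanSpace ℝ (Fin d))
    (hseq0 : seq 0 = lr)
    (hseq : ∀ (k : ℕ) (i : Fin d), seq (k + 1) i
        = seq k i + ∑ j, (gram p (seq k))⁻¹ i j * ⟪q - p (seq k), pderiv p j (seq k)⟫)
    (α : ℝ) (hα : α = 1 / 2 * (d : ℝ) * C1 * C2 * ‖lo - lr‖ + (d : ℝ) * ν * C2) :
    Filter.Tendsto seq Filter.atTop (nhds lo) ∧ α < 1 ∧
      ∀ k, ‖seq k - lo‖ ≤ α ^ k * ‖lo - lr‖ := by
  subst hν hq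
  have hd' : (0 : ℝ) < d := Nat.cast_pos.mpr hd
  have hα0 : 0 ≤ α := by
    rw [hα]
    positivity
  have hα1 : α < 1 := by
    have h := mul_lt_mul_of_pos_left hinit (show 0 < 1 / 2 * (d : ℝ) * C1 * C2 by positivity)
    have heq : 1 / 2 * (d : ℝ) * C1 * C2 * (2 / C1 * (1 / ((d : ℝ) * C2) - ‖n‖))
        = 1 - d * ‖n‖ * C2 := by
      field_simp
    rw [heq] at h
    rw [hα]
    linarith
  have hbound (k : ℕ) : ‖seq k - lo‖ ≤ α ^ k * ‖lo - lr‖ := by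
    induction k with
    | zero => simp [hseq0, norm_sub_rev]
    | succ k ih =>
      have hstep := norm_tangent_distance_sub_le hd hp hK hKb (hPD (seq k)) (hC1b (seq k))
        (hC2b (seq k)) hn (hseq k)
      rw [norm_sub_rev lo (seq k)] at hstep
      have hle : ‖seq k - lo‖ ≤ ‖lo - lr‖ :=
        ih.trans (mul_le_of_le_one_left (norm_nonneg _) (pow_le_one₀ hα0 hα1.le))
      calc ‖seq (k + 1) - lo‖ ≤ _ := hstep
        _ ≤ α * (α ^ k * ‖lo - lr‖) := by
          rw [hα] at ih ⊢
          gcongr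
        _ = _ := by ring
  refine ⟨?_, hα1, hbound⟩
  rw [tendsto_iff_norm_sub_tendsto_zero]
  refine squeeze_zero (fun _ => norm_nonneg _) hbound ?_
  simpa using (tendsto_pow_atTop_nhds_zero_of_lt_one hα0 hα1).mul_const ‖lo - lr‖
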